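/- Let F = ℚ(t) be the field of rational functions in the variable t over ℚ, and work in the field F(q) of rational functions in q over F. Fix a positive integer r and partitions λ^1,…,λ^r, and for each subset I ⊆ [r] set u_I = h_{(q,t)}(λ^I), where λ^I = ⊕_{i∈I} λ^i. Then the family (u_I) has the small cumulant property at q = 1: for every subset H ⊆ [r] with |H| ≥ 2, κ_H(u)/(∏_{h∈H} u_{{h}}) = O_1((q−1)^{|H|−1}). -/

import Mathlib

/-- A partition encoded as a weakly decreasing function `ℕ → ℕ` with finite support. -/
structure PartitionFun where
  toFun : ℕ → ℕ
  antitone' : ∀ ⦃i j : ℕ⦄, i ≤ j → toFun j ≤ toFun i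
  finite_support' : (Function.support toFun).Finite

/-- The entry-wise sum `λ^I = ⊕_{k ∈ I} λ^k` of a family of partitions. -/
def partSum {r : ℕ} (lam : Fin r → PartitionFun) (I : Finset (Fin r)) : PartitionFun where
  toFun := fun n => ∑ k ∈ I, (lam k).toFun n
  antitone' := fun i j hij => Finset.sum_le_sum fun k _ => (lam k).antitone' hij
  finite_support' := by
    apply Set.Finite.subset
      (Set.Finite.biUnion I.finite_toSet fun k _ => (lam k).finite_support')
    intro n hn
    obtain ⟨k, hk, hk0⟩ :=
      Finset.exists_ne_zero_of_sum_ne_zero (Function.mem_support.mp hn)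
    exact Set.mem_biUnion hk hk0

/-- The `(q,t)`-hook polynomial `h_{(q,t)}(λ) = ∏_{(i,j) ∈ λ} (1 − q^{a(i,j)} t^{ℓ(i,j)+1})`,
an element of `F(q)` where `F = ℚ(t)`; the cells of `λ` are the pairs `(i,j)` with
`j < λ(i)`, the arm-length is `a(i,j) = λ(i) − j − 1` and the leg-length is
`ℓ(i,j) = #{i' : λ(i') > j} − i − 1`. -/
noncomputable def hookPoly (lam : PartitionFun) : RatFunc (RatFunc ℚ) :=
  ∏ᶠ (p : ℕ × ℕ) (_ : p.2 < lam.toFun p.1),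
    (1 - (RatFunc.X : RatFunc (RatFunc ℚ)) ^ (lam.toFun p.1 - p.2 - 1) *
      RatFunc.C (RatFunc.X : RatFunc ℚ) ^
        ({i' : ℕ | p.2 < lam.toFun i'}.ncard - p.1 - 1 + 1))

/-- `f = O_c(g)`: the rational function `f/g` has no pole at `q = c`. -/
def IsOAt {F : Type*} [Field F] (c : F) (f g : RatFunc F) : Prop :=
  ∃ a b : Polynomial F, Polynomial.eval c b ≠ 0 ∧
    f * algebraMap (Polynomial F) (RatFunc F) b =
      g * algebraMap (Polynomial F) (RatFunc F) a

/-- The set of all set partitions of a finite set `s` into nonempty blocks. -/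
def partitionsOf {α : Type*} [DecidableEq α] (s : Finset α) : Finset (Finset (Finset α)) :=
  s.powerset.powerset.filter
    (fun π => (∀ B ∈ π, B ≠ ∅) ∧ (∀ B ∈ π, ∀ B' ∈ π, B ≠ B' → B ∩ B' = ∅) ∧
      π.sup id = s)

/-- The partial cumulant `κ_H(u) = Σ_{π ∈ P(H)} (−1)^{#π−1}(#π−1)! ∏_{B∈π} u_B`. -/
def cumulant {α K : Type*} [DecidableEq α] [CommRing K] (u : Finset α → K)
    (H : Finset α) : K :=
  ∑ π ∈ partitionsOf H,
    ((-1 : ℤ) ^ (π.card - 1) * (π.card - 1).factorial) • ∏ B ∈ π, u B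

section Cumulant

variable {α K : Type*} [DecidableEq α]

theorem mem_partitionsOf {s : Finset α} {π : Finset (Finset α)} :
    π ∈ partitionsOf s ↔ (∀ B ∈ π, B ≠ ∅) ∧
      (∀ B ∈ π, ∀ B' ∈ π, B ≠ B' → B ∩ B' = ∅) ∧ π.sup id = s := by
  unfold partitionsOf
  rw [Finset.mem_filter, and_iff_right_iff_imp]
  rintro ⟨-, -, rfl⟩
  rw [Finset.mem_powerset]
  intro B hB
  exact Finset.mem_powerset.2 (Finset.le_sup (f := id) hB)

theorem subset_of_mem_partitionsOf {s : Finset α} {π : Finset (Finset α)}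
    (hπ : π ∈ partitionsOf s) {B : Finset α} (hB : B ∈ π) : B ⊆ s := by
  rw [← (mem_partitionsOf.1 hπ).2.2]
  exact Finset.le_sup (f := id) hB

theorem exists_mem_of_mem_partitionsOf {s : Finset α} {π : Finset (Finset α)}
    (hπ : π ∈ partitionsOf s) {g : α} (hg : g ∈ s) : ∃ B ∈ π, g ∈ B := by
  rw [← (mem_partitionsOf.1 hπ).2.2, Finset.mem_sup] at hg
  exact hg

theorem card_filter_notMem_of_mem_partitionsOf {s : Finset α} {π : Finset (Finset α)}
    (hπ : π ∈ partitionsOf s) {g : α} (hg : g ∈ s) :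
    (π.filter (fun C => g ∉ C)).card = π.card - 1 := by
  obtain ⟨B, hB, hgB⟩ := exists_mem_of_mem_partitionsOf hπ hg
  rw [← Finset.card_erase_of_mem hB]
  congr 1
  ext C
  simp only [Finset.mem_filter, Finset.mem_erase]
  constructor
  · rintro ⟨hC, hgC⟩
    exact ⟨fun h => hgC (h ▸ hgB), hC⟩
  · rintro ⟨hne, hC⟩
    refine ⟨hC, fun hgC => ?_⟩
    have := (mem_partitionsOf.1 hπ).2.1 C hC B hB hne
    exact Finset.notMem_empty g (this ▸ Finset.mem_inter.2 ⟨hgC, hgB⟩)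

theorem insert_mem_partitionsOf {s C : Finset α} {π : Finset (Finset α)} (hC : C ≠ ∅)
    (hCs : C ⊆ s) (hπ : π ∈ partitionsOf (s \ C)) : insert C π ∈ partitionsOf s := by
  have hdisj : ∀ B ∈ π, B ∩ C = ∅ := fun B hB =>
    Finset.disjoint_iff_inter_eq_empty.1
      (Finset.disjoint_of_subset_left (subset_of_mem_partitionsOf hπ hB) Finset.sdiff_disjoint)
  obtain ⟨h1, h2, h3⟩ := mem_partitionsOf.1 hπ
  refine mem_partitionsOf.2 ⟨?_, ?_, ?_⟩
  · intro B hB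
    rcases Finset.mem_insert.1 hB with rfl | hB
    exacts [hC, h1 B hB]
  · intro B hB B' hB' hne
    rw [Finset.mem_insert] at hB hB'
    rcases hB with rfl | hB <;> rcases hB' with rfl | hB'
    · exact absurd rfl hne
    · rw [Finset.inter_comm]; exact hdisj B' hB'
    · exact hdisj B hB
    · exact h2 B hB B' hB' hne
  · rw [Finset.sup_insert, h3]
    exact Finset.union_sdiff_of_subset hCs

theorem notMem_of_mem_partitionsOf_sdiff {s C : Finset α} {π : Finset (Finset α)} (hC : C ≠ ∅)
    (hπ : π ∈ partitionsOf (s \ C)) : C ∉ π := fun h =>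
  hC (Finset.disjoint_self_iff_empty C |>.1
    (Finset.disjoint_of_subset_left (subset_of_mem_partitionsOf hπ h) Finset.sdiff_disjoint))

theorem erase_mem_partitionsOf {s C : Finset α} {π : Finset (Finset α)}
    (hπ : π ∈ partitionsOf s) (hC : C ∈ π) : π.erase C ∈ partitionsOf (s \ C) := by
  obtain ⟨h1, h2, h3⟩ := mem_partitionsOf.1 hπ
  refine mem_partitionsOf.2 ⟨fun B hB => h1 B (Finset.mem_of_mem_erase hB),
    fun B hB B' hB' => h2 B (Finset.mem_of_mem_erase hB) B' (Finset.mem_of_mem_erase hB'), ?_⟩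
  have hdisj : Disjoint ((π.erase C).sup id) C := by
    rw [Finset.disjoint_sup_left]
    intro B hB
    exact Finset.disjoint_iff_inter_eq_empty.2
      (h2 B (Finset.mem_of_mem_erase hB) C hC (Finset.ne_of_mem_erase hB))
  rw [← h3]
  conv_rhs => rw [← Finset.insert_erase hC, Finset.sup_insert]
  exact (Finset.union_sdiff_cancel_left hdisj.symm).symm

variable [CommRing K]

/-- The recursion expressing moments through cumulants of the blocks containing a given point. -/
theorem sum_cumulant_sdiff_mul (u : Finset α → K) (hu : u ∅ = 1) {s : Finset α} {g : α}
    (hg : g ∈ s) :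
    ∑ C ∈ (s.erase g).powerset, cumulant u (s \ C) * u C = u s := by
  set c : ℕ → ℤ := fun m => (-1 : ℤ) ^ (m - 1) * (m - 1).factorial with hc
  have hκ : ∀ t, cumulant u t = ∑ π ∈ partitionsOf t, c π.card • ∏ B ∈ π, u B := fun t => rfl
  have key : ∑ C ∈ (s.erase g).powerset.erase ∅, cumulant u (s \ C) * u C =
      ∑ σ ∈ partitionsOf s, (((σ.card - 1 : ℕ) : ℤ) * c (σ.card - 1)) • ∏ B ∈ σ, u B := by
    have h1 : ∀ σ ∈ partitionsOf s,
        (((σ.card - 1 : ℕ) : ℤ) * c (σ.card - 1)) • ∏ B ∈ σ, u B =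
          ∑ C ∈ σ.filter (fun C => g ∉ C), c (σ.card - 1) • ∏ B ∈ σ, u B := by
      intro σ hσ
      rw [Finset.sum_const, card_filter_notMem_of_mem_partitionsOf hσ hg, mul_smul, natCast_zsmul]
    rw [Finset.sum_congr rfl h1]
    simp_rw [hκ, Finset.sum_mul]
    rw [Finset.sum_sigma', Finset.sum_sigma']
    refine Finset.sum_bij' (fun x _ => ⟨insert x.1 x.2, x.1⟩) (fun y _ => ⟨y.2, y.1.erase y.2⟩)
      ?_ ?_ ?_ ?_ ?_
    · rintro ⟨C, π⟩ h
      simp only [Finset.mem_sigma, Finset.mem_erase, Finset.mem_powerset, Finset.mem_filter] at h ⊢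
      exact ⟨insert_mem_partitionsOf h.1.1 (h.1.2.trans (Finset.erase_subset _ _)) h.2,
        Finset.mem_insert_self _ _, fun hgC => Finset.notMem_erase g s (h.1.2 hgC)⟩
    · rintro ⟨σ, C⟩ h
      simp only [Finset.mem_sigma, Finset.mem_erase, Finset.mem_powerset, Finset.mem_filter] at h ⊢
      exact ⟨⟨(mem_partitionsOf.1 h.1).1 C h.2.1,
        Finset.subset_erase.2 ⟨subset_of_mem_partitionsOf h.1 h.2.1, h.2.2⟩⟩,
        erase_mem_partitionsOf h.1 h.2.1⟩
    · rintro ⟨C, π⟩ h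
      simp only [Finset.mem_sigma, Finset.mem_erase, Finset.mem_powerset] at h
      simp only [Finset.erase_insert (notMem_of_mem_partitionsOf_sdiff h.1.1 h.2)]
    · rintro ⟨σ, C⟩ h
      simp only [Finset.mem_sigma, Finset.mem_filter] at h
      simp only [Finset.insert_erase h.2.1]
    · rintro ⟨C, π⟩ h
      simp only [Finset.mem_sigma, Finset.mem_erase, Finset.mem_powerset] at h
      have hn := notMem_of_mem_partitionsOf_sdiff h.1.1 h.2
      simp only [Finset.card_insert_of_notMem hn, Finset.prod_insert hn, Nat.add_sub_cancel]
      rw [smul_mul_assoc, mul_comm (u C)]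
  rw [← Finset.add_sum_erase _ _ (Finset.empty_mem_powerset _), key, hu, mul_one,
    Finset.sdiff_empty, hκ, ← Finset.sum_add_distrib]
  simp_rw [← add_smul]
  have hs : s ≠ ∅ := Finset.ne_empty_of_mem hg
  rw [Finset.sum_eq_single {s}]
  · simp [hc]
  · intro σ hσ hne
    have h0 : σ.card ≠ 0 := by
      obtain ⟨B, hB, -⟩ := exists_mem_of_mem_partitionsOf hσ hg
      exact Finset.card_ne_zero_of_mem hB
    have h1 : σ.card ≠ 1 := by
      intro h
      obtain ⟨B, rfl⟩ := Finset.card_eq_one.1 h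
      have := (mem_partitionsOf.1 hσ).2.2
      simp only [Finset.sup_singleton, id] at this
      exact hne (by rw [this])
    obtain ⟨m, hm⟩ : ∃ m, σ.card = m + 2 := ⟨σ.card - 2, by omega⟩
    have : c σ.card + ((σ.card - 1 : ℕ) : ℤ) * c (σ.card - 1) = 0 := by
      simp only [hc, hm, Nat.add_sub_cancel, show m + 2 - 1 = m + 1 by omega,
        Nat.factorial_succ]
      push_cast
      ring
    rw [this, zero_smul]
  · intro h
    refine absurd (mem_partitionsOf.2 ⟨?_, ?_, ?_⟩) h <;> simp [hs]

end Cumulant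

section SubsetConvolution

variable {α K : Type*} [DecidableEq α] [CommRing K]

/-- Subset convolution of two set functions. -/
def subsetConv (φ ψ : Finset α → K) (I : Finset α) : K :=
  ∑ J ∈ I.powerset, φ J * ψ (I \ J)

theorem subsetConv_congr {φ φ' ψ ψ' : Finset α → K} {I : Finset α}
    (h : ∀ J ⊆ I, φ J = φ' J) (h' : ∀ J ⊆ I, ψ J = ψ' J) :
    subsetConv φ ψ I = subsetConv φ' ψ' I :=
  Finset.sum_congr rfl fun J hJ => by
    rw [h J (Finset.mem_powerset.1 hJ), h' _ Finset.sdiff_subset]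

theorem subsetConv_comm (φ ψ : Finset α → K) (I : Finset α) :
    subsetConv φ ψ I = subsetConv ψ φ I := by
  refine Finset.sum_bij' (fun J _ => I \ J) (fun J _ => I \ J) ?_ ?_ ?_ ?_ ?_
  · simp
  · simp
  · intro J hJ
    exact Finset.sdiff_sdiff_eq_self (Finset.mem_powerset.1 hJ)
  · intro J hJ
    exact Finset.sdiff_sdiff_eq_self (Finset.mem_powerset.1 hJ)
  · intro J hJ
    rw [Finset.sdiff_sdiff_eq_self (Finset.mem_powerset.1 hJ), mul_comm]

theorem subsetConv_assoc (φ ψ χ : Finset α → K) (I : Finset α) :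
    subsetConv (subsetConv φ ψ) χ I = subsetConv φ (subsetConv ψ χ) I := by
  unfold subsetConv
  simp_rw [Finset.sum_mul, Finset.mul_sum]
  rw [Finset.sum_sigma', Finset.sum_sigma']
  refine Finset.sum_bij' (fun x _ => ⟨x.2, x.1 \ x.2⟩) (fun y _ => ⟨y.1 ∪ y.2, y.1⟩)
    ?_ ?_ ?_ ?_ ?_
  · rintro ⟨J, L⟩ h
    simp only [Finset.mem_sigma, Finset.mem_powerset] at h ⊢
    exact ⟨h.2.trans h.1, Finset.sdiff_subset_sdiff h.1 subset_rfl⟩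
  · rintro ⟨J, L⟩ h
    simp only [Finset.mem_sigma, Finset.mem_powerset] at h ⊢
    exact ⟨Finset.union_subset h.1 (h.2.trans Finset.sdiff_subset), Finset.subset_union_left⟩
  · rintro ⟨J, L⟩ h
    simp only [Finset.mem_sigma, Finset.mem_powerset] at h
    simp only [Finset.union_sdiff_of_subset h.2]
  · rintro ⟨J, L⟩ h
    simp only [Finset.mem_sigma, Finset.mem_powerset] at h
    have hd : Disjoint J L :=
      (Finset.disjoint_of_subset_left h.2 Finset.sdiff_disjoint).symm
    simp only [Finset.union_sdiff_cancel_left hd]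
  · rintro ⟨J, L⟩ h
    simp only [Finset.mem_sigma, Finset.mem_powerset] at h
    have : (I \ L) \ (J \ L) = I \ J := by
      rw [sdiff_sdiff_left, Finset.sup_eq_union, Finset.union_sdiff_of_subset h.2]
    simp only [this, mul_assoc]

theorem subsetConv_insert (φ ψ : Finset α → K) {I : Finset α} {h : α} (hI : h ∉ I) :
    subsetConv φ ψ (insert h I) =
      subsetConv (fun J => φ (insert h J)) ψ I + subsetConv φ (fun J => ψ (insert h J)) I := by
  unfold subsetConv
  rw [Finset.sum_powerset_insert hI, add_comm]
  congr 1
  · refine Finset.sum_congr rfl fun J hJ => ?_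
    rw [Finset.insert_sdiff_insert, Finset.sdiff_insert_of_notMem hI]
  · refine Finset.sum_congr rfl fun J hJ => ?_
    rw [Finset.insert_sdiff_of_notMem _ fun h' => hI (Finset.mem_powerset.1 hJ h')]

theorem subsetConv_right_cancel {φ ψ u : Finset α → K} (hu : u ∅ = 1) (I : Finset α)
    (h : ∀ J ⊆ I, subsetConv φ u J = subsetConv ψ u J) : φ I = ψ I := by
  induction I using Finset.strongInduction with
  | H I ih =>
    have hI := h I subset_rfl
    unfold subsetConv at hI
    rw [← Finset.add_sum_erase _ _ (Finset.mem_powerset_self I),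
      ← Finset.add_sum_erase _ (fun J => ψ J * u (I \ J)) (Finset.mem_powerset_self I)] at hI
    have : ∑ J ∈ I.powerset.erase I, φ J * u (I \ J) =
        ∑ J ∈ I.powerset.erase I, ψ J * u (I \ J) := by
      refine Finset.sum_congr rfl fun J hJ => ?_
      rw [Finset.mem_erase, Finset.mem_powerset] at hJ
      rw [ih J (hJ.2.ssubset_of_ne hJ.1) fun L hL => h L (hL.trans hJ.2)]
    rw [this] at hI
    simpa only [Finset.sdiff_self, hu, mul_one, add_left_inj] using hI

theorem subsetConv_cumulant_insert {u : Finset α → K} (hu : u ∅ = 1) {I : Finset α} {g : α}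
    (hg : g ∉ I) :
    subsetConv (fun J => cumulant u (insert g J)) u I = u (insert g I) := by
  rw [subsetConv_comm, ← sum_cumulant_sdiff_mul u hu (Finset.mem_insert_self g I),
    Finset.erase_insert hg]
  refine Finset.sum_congr rfl fun J hJ => ?_
  rw [Finset.insert_sdiff_of_notMem _ fun h' => hg (Finset.mem_powerset.1 hJ h'), mul_comm]

end SubsetConvolution

section ShiftRecursion

variable {α K V : Type*} [DecidableEq α] [Field K] [AddCommMonoid V]

/-- The normalised values of `F` at the translates of `n` by partial sums of `c`. -/
def shiftFamily (c : α → V) (F : V → K) (n : V) (I : Finset α) : K :=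
  F (n + ∑ i ∈ I, c i) / F n

theorem cumulant_insert_insert (c : α → V) {F : V → K} (hF : ∀ n, F n ≠ 0) (n : V)
    {I : Finset α} {g h : α} (hgh : g ≠ h) (hg : g ∉ I) (hh : h ∉ I) :
    cumulant (shiftFamily c F n) (insert h (insert g I)) =
      ∑ J ∈ I.powerset, cumulant (shiftFamily c F n) (insert g J) *
        (cumulant (shiftFamily c F (n + c g)) (insert h (I \ J)) -
          cumulant (shiftFamily c F n) (insert h (I \ J))) := by
  have hu : ∀ m, shiftFamily c F m ∅ = 1 := fun m => by simp [shiftFamily, hF m]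
  set u := shiftFamily c F n with hu_def
  set u' := shiftFamily c F (n + c g) with hu'_def
  have hu₁ : u ∅ = 1 := hu n
  have hu₂ : u' ∅ = 1 := hu (n + c g)
  have hstep : ∀ J : Finset α, g ∉ J → u (insert g J) = F (n + c g) / F n * u' J := by
    intro J hJ
    simp only [hu_def, hu'_def, shiftFamily, Finset.sum_insert hJ, add_assoc]
    field_simp [hF n, hF (n + c g)]
  refine subsetConv_right_cancel (φ := fun J => cumulant u (insert h (insert g J)))
    (ψ := subsetConv (fun J => cumulant u (insert g J))
      (fun J => cumulant u' (insert h J) - cumulant u (insert h J))) hu₁ I fun J hJ => ?_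
  have hgJ : g ∉ J := fun h' => hg (hJ h')
  have hhJ : h ∉ J := fun h' => hh (hJ h')
  have e1 := subsetConv_insert (fun J => cumulant u (insert g J)) u hhJ
  rw [subsetConv_cumulant_insert hu₁
    (by simp [hgh, hgJ] : g ∉ insert h J)] at e1
  have e2 : subsetConv (fun J => cumulant u (insert g J)) (fun J => u (insert h J)) J =
      subsetConv (subsetConv (fun J => cumulant u (insert g J))
        (fun J => cumulant u (insert h J))) u J := by
    rw [subsetConv_assoc]
    exact subsetConv_congr (fun _ _ => rfl) fun L hL =>
      (subsetConv_cumulant_insert hu₁ fun h' => hhJ (hL h')).symm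
  have e3 : u (insert g (insert h J)) =
      subsetConv (subsetConv (fun J => cumulant u (insert g J))
        (fun J => cumulant u' (insert h J))) u J := by
    rw [hstep _ (by simp [hgh, hgJ]), ← subsetConv_cumulant_insert hu₂ hhJ,
      funext (subsetConv_comm (fun J => cumulant u (insert g J)) _), subsetConv_assoc,
      subsetConv, subsetConv, Finset.mul_sum]
    refine Finset.sum_congr rfl fun L hL => ?_
    rw [subsetConv_cumulant_insert hu₁ fun h' => hgJ (Finset.sdiff_subset h'),
      hstep _ fun h' => hgJ (Finset.sdiff_subset h')]
    ring
  have e4 : subsetConv (subsetConv (fun J => cumulant u (insert g J))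
        (fun J => cumulant u' (insert h J) - cumulant u (insert h J))) u J =
      subsetConv (subsetConv (fun J => cumulant u (insert g J))
        (fun J => cumulant u' (insert h J))) u J -
      subsetConv (subsetConv (fun J => cumulant u (insert g J))
        (fun J => cumulant u (insert h J))) u J := by
    simp only [subsetConv, mul_sub, sub_mul, Finset.sum_sub_distrib]
  rw [e4, ← e2, ← e3, e1]
  simp only [Finset.insert_comm h g]
  ring

end ShiftRecursion

section Filtration

variable {α K V : Type*} [Field K] [AddCommMonoid V]

/-- The first `N` iterated differences of `φ` along the steps `c` gain one level each in the
filtration `M`, starting from level `j`. -/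
def SmallDiff (M : ℕ → AddSubgroup K) (c : α → V) : ℕ → ℕ → (V → K) → Prop
  | 0, j, φ => ∀ n, φ n ∈ M j
  | N + 1, j, φ => (∀ n, φ n ∈ M j) ∧
      ∀ g, SmallDiff M c N (j + 1) (fun n => φ (n + c g) - φ n)

namespace SmallDiff

variable {M : ℕ → AddSubgroup K} {c : α → V} {N i j : ℕ} {φ ψ : V → K}

theorem mem (h : SmallDiff M c N j φ) (n : V) : φ n ∈ M j := by
  cases N with
  | zero => exact h n
  | succ N => exact h.1 n

theorem of_succ (h : SmallDiff M c (N + 1) j φ) : SmallDiff M c N j φ := by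
  induction N generalizing j φ with
  | zero => exact h.1
  | succ N ih => exact ⟨h.1, fun g => ih (h.2 g)⟩

theorem shift (h : SmallDiff M c N j φ) (v : V) : SmallDiff M c N j (fun n => φ (n + v)) := by
  induction N generalizing j φ with
  | zero => exact fun n => h _
  | succ N ih =>
    refine ⟨fun n => h.1 _, fun g => ?_⟩
    simpa only [add_right_comm _ v] using ih (h.2 g)

theorem add (hφ : SmallDiff M c N j φ) (hψ : SmallDiff M c N j ψ) :
    SmallDiff M c N j (fun n => φ n + ψ n) := by
  induction N generalizing j φ ψ with
  | zero => exact fun n => add_mem (hφ n) (hψ n)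
  | succ N ih =>
    refine ⟨fun n => add_mem (hφ.1 n) (hψ.1 n), fun g => ?_⟩
    simpa only [add_sub_add_comm] using ih (hφ.2 g) (hψ.2 g)

theorem neg (hφ : SmallDiff M c N j φ) : SmallDiff M c N j (fun n => -φ n) := by
  induction N generalizing j φ with
  | zero => exact fun n => neg_mem (hφ n)
  | succ N ih =>
    refine ⟨fun n => neg_mem (hφ.1 n), fun g => ?_⟩
    convert ih (hφ.2 g) using 2
    ring

theorem zero (N j : ℕ) : SmallDiff M c N j (fun _ => 0) := by
  induction N generalizing j with
  | zero => exact fun _ => zero_mem _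
  | succ N ih =>
    refine ⟨fun _ => zero_mem _, fun g => ?_⟩
    simpa only [sub_self] using ih (j + 1)

theorem const {x : K} (hx : x ∈ M j) (N : ℕ) : SmallDiff M c N j (fun _ => x) := by
  cases N with
  | zero => exact fun _ => hx
  | succ N =>
    refine ⟨fun _ => hx, fun g => ?_⟩
    simpa only [sub_self] using zero N (j + 1)

theorem sum {ι : Type*} (s : Finset ι) {φ : ι → V → K}
    (h : ∀ x ∈ s, SmallDiff M c N j (φ x)) : SmallDiff M c N j (fun n => ∑ x ∈ s, φ x n) := by
  classical
  induction s using Finset.induction_on with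
  | empty => simpa only [Finset.sum_empty] using zero N j
  | insert a s ha ih =>
    simp only [Finset.sum_insert ha]
    exact (h a (Finset.mem_insert_self _ _)).add
      (ih fun x hx => h x (Finset.mem_insert_of_mem hx))

theorem mul (hM : ∀ {i j x y}, x ∈ M i → y ∈ M j → x * y ∈ M (i + j))
    (hφ : SmallDiff M c N i φ) (hψ : SmallDiff M c N j ψ) :
    SmallDiff M c N (i + j) (fun n => φ n * ψ n) := by
  induction N generalizing i j φ ψ with
  | zero => exact fun n => hM (hφ n) (hψ n)
  | succ N ih =>
    refine ⟨fun n => hM (hφ.1 n) (hψ.1 n), fun g => ?_⟩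
    have h1 := ih (hφ.2 g) (hψ.of_succ.shift (c g))
    have h2 := ih hφ.of_succ (hψ.2 g)
    rw [show i + 1 + j = i + j + 1 by omega] at h1
    convert h1.add h2 using 2
    ring

theorem prod (hM : ∀ {i j x y}, x ∈ M i → y ∈ M j → x * y ∈ M (i + j)) (hM1 : 1 ∈ M 0)
    {ι : Type*} (s : Finset ι) {φ : ι → V → K}
    (h : ∀ x ∈ s, SmallDiff M c N 0 (φ x)) : SmallDiff M c N 0 (fun n => ∏ x ∈ s, φ x n) := by
  classical
  induction s using Finset.induction_on with
  | empty => simpa only [Finset.prod_empty] using const hM1 N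
  | insert a s ha ih =>
    simp only [Finset.prod_insert ha]
    exact (h a (Finset.mem_insert_self _ _)).mul hM
      (ih fun x hx => h x (Finset.mem_insert_of_mem hx))

theorem inv (hM : ∀ {i j x y}, x ∈ M i → y ∈ M j → x * y ∈ M (i + j))
    (h0 : ∀ n, φ n ≠ 0) (hinv : ∀ n, (φ n)⁻¹ ∈ M 0) (hφ : SmallDiff M c N 0 φ) :
    SmallDiff M c N 0 (fun n => (φ n)⁻¹) := by
  induction N with
  | zero => exact hinv
  | succ N ih =>
    refine ⟨hinv, fun g => ?_⟩
    have hi := ih hφ.of_succ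
    have := ((hφ.2 g).neg.mul hM hi).mul hM (hi.shift (c g))
    convert this using 2 with n
    field_simp [h0 n, h0 (n + c g)]
    ring

end SmallDiff

/-- If the one-step ratios of `F` have small differences, then so do the cumulants of the
normalised values of `F`. -/
theorem smallDiff_cumulant [DecidableEq α] {M : ℕ → AddSubgroup K}
    (hM : ∀ {i j x y}, x ∈ M i → y ∈ M j → x * y ∈ M (i + j)) (c : α → V) {F : V → K}
    (hF : ∀ n, F n ≠ 0) (hratio : ∀ g N, SmallDiff M c N 0 (fun n => F (n + c g) / F n))
    (I : Finset α) (g : α) (hg : g ∉ I) (N : ℕ) :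
    SmallDiff M c N I.card (fun n => cumulant (shiftFamily c F n) (insert g I)) := by
  induction hI : I.card using Nat.strong_induction_on generalizing I g N with
  | _ m ih =>
    subst hI
    rcases I.eq_empty_or_nonempty with rfl | ⟨h, hh⟩
    · rw [Finset.card_empty]
      convert hratio g N using 2 with n
      have hu : shiftFamily c F n ∅ = 1 := by simp [shiftFamily, hF n]
      have := sum_cumulant_sdiff_mul (shiftFamily c F n) hu (Finset.mem_singleton_self g)
      simp only [Finset.erase_singleton, Finset.powerset_empty, Finset.sum_singleton,
        Finset.sdiff_empty, hu, mul_one] at this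
      rw [insert_empty_eq, this, shiftFamily, Finset.sum_singleton]
    · obtain ⟨I, hhI, rfl⟩ : ∃ I', h ∉ I' ∧ insert h I' = I :=
        ⟨I.erase h, Finset.notMem_erase _ _, Finset.insert_erase hh⟩
      rw [Finset.mem_insert, not_or] at hg
      rw [Finset.card_insert_of_notMem hhI] at ih ⊢
      simp only [Finset.insert_comm g h, cumulant_insert_insert c hF _ hg.1 hg.2 hhI]
      refine SmallDiff.sum _ fun J hJ => ?_
      rw [Finset.mem_powerset] at hJ
      have hcard := Finset.card_sdiff_add_card_eq_card hJ
      have h1 := ih J.card (by omega) J g (fun h' => hg.2 (hJ h')) N rfl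
      have h2 := (ih (I \ J).card (by omega) (I \ J) h
        (fun h' => hhI (Finset.sdiff_subset h')) (N + 1) rfl).2 g
      convert h1.mul hM h2 using 1
      omega

/-- `F` is nowhere zero, and its one-step ratios and their inverses have small differences. -/
structure SmallRatio (M : ℕ → AddSubgroup K) (c : α → V) (F : V → K) : Prop where
  ne_zero : ∀ n, F n ≠ 0
  ratio : ∀ g N, SmallDiff M c N 0 (fun n => F (n + c g) / F n)
  ratio_inv : ∀ g N, SmallDiff M c N 0 (fun n => F n / F (n + c g))

namespace SmallRatio

variable {M : ℕ → AddSubgroup K} {c : α → V} {F G : V → K}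

theorem div (hM : ∀ {i j x y}, x ∈ M i → y ∈ M j → x * y ∈ M (i + j))
    (hF : SmallRatio M c F) (hG : SmallRatio M c G) : SmallRatio M c (fun n => F n / G n) where
  ne_zero n := div_ne_zero (hF.ne_zero n) (hG.ne_zero n)
  ratio g N := by
    convert (hF.ratio g N).mul hM (hG.ratio_inv g N) using 2 with n
    rw [div_div_div_eq, div_mul_div_comm, mul_comm (G (n + c g))]
  ratio_inv g N := by
    convert (hF.ratio_inv g N).mul hM (hG.ratio g N) using 2 with n
    rw [div_div_div_eq, div_mul_div_comm, mul_comm (G n)]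

theorem prod (hM : ∀ {i j x y}, x ∈ M i → y ∈ M j → x * y ∈ M (i + j)) (hM1 : 1 ∈ M 0)
    {ι : Type*} (s : Finset ι) {F : ι → V → K} (h : ∀ x ∈ s, SmallRatio M c (F x)) :
    SmallRatio M c (fun n => ∏ x ∈ s, F x n) where
  ne_zero n := Finset.prod_ne_zero_iff.2 fun x hx => (h x hx).ne_zero n
  ratio g N := by
    simp only [← Finset.prod_div_distrib]
    exact SmallDiff.prod hM hM1 s fun x hx => (h x hx).ratio g N
  ratio_inv g N := by
    simp only [← Finset.prod_div_distrib]
    exact SmallDiff.prod hM hM1 s fun x hx => (h x hx).ratio_inv g N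

end SmallRatio

end Filtration

section OrderAtOne

open Polynomial

variable {E : Type*} [Field E]

/-- The rational functions that vanish to order at least `j` at `1`. -/
def orderAtOne (E : Type*) [Field E] (j : ℕ) : AddSubgroup (RatFunc E) where
  carrier := {f | IsOAt 1 f ((RatFunc.X - 1) ^ j)}
  zero_mem' := ⟨0, 1, by simp, by simp⟩
  add_mem' := by
    rintro f g ⟨a, b, hb, h⟩ ⟨a', b', hb', h'⟩
    refine ⟨a * b' + a' * b, b * b', by simp [hb, hb'], ?_⟩
    simp only [map_add, map_mul]
    linear_combination h * algebraMap E[X] (RatFunc E) b' + h' * algebraMap E[X] (RatFunc E) b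
  neg_mem' := by
    rintro f ⟨a, b, hb, h⟩
    refine ⟨-a, b, hb, ?_⟩
    simp only [map_neg]
    linear_combination -h

theorem mul_mem_orderAtOne {i j : ℕ} {f g : RatFunc E} (hf : f ∈ orderAtOne E i)
    (hg : g ∈ orderAtOne E j) : f * g ∈ orderAtOne E (i + j) := by
  obtain ⟨a, b, hb, h⟩ := hf
  obtain ⟨a', b', hb', h'⟩ := hg
  refine ⟨a * a', b * b', by simp [hb, hb'], ?_⟩
  simp only [map_mul, pow_add]
  rw [mul_mul_mul_comm, h, h']
  ring

theorem algebraMap_mem_orderAtOne (p : E[X]) :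
    algebraMap E[X] (RatFunc E) p ∈ orderAtOne E 0 :=
  ⟨p, 1, by simp, by simp⟩

theorem one_mem_orderAtOne : (1 : RatFunc E) ∈ orderAtOne E 0 := by
  simpa using algebraMap_mem_orderAtOne (1 : E[X])

theorem X_pow_sub_one_mem_orderAtOne (m : ℕ) :
    (RatFunc.X ^ m - 1 : RatFunc E) ∈ orderAtOne E 1 := by
  obtain ⟨a, ha⟩ := sub_one_dvd_pow_sub_one (X : E[X]) m
  refine ⟨a, 1, by simp, ?_⟩
  have := congrArg (algebraMap E[X] (RatFunc E)) ha
  simpa using this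

theorem one_sub_X_pow_mul_C_eq (m : ℕ) (x : E) :
    (1 - RatFunc.X ^ m * RatFunc.C x : RatFunc E) =
      algebraMap E[X] (RatFunc E) (1 - X ^ m * C x) := by
  simp only [map_sub, map_one, map_mul, map_pow, RatFunc.algebraMap_X, RatFunc.algebraMap_C]

theorem one_sub_X_pow_mul_C_ne_zero (m : ℕ) {x : E} (hx : x ≠ 1) :
    (1 - RatFunc.X ^ m * RatFunc.C x : RatFunc E) ≠ 0 := by
  rw [one_sub_X_pow_mul_C_eq]
  intro h
  rw [map_eq_zero_iff _ (RatFunc.algebraMap_injective E)] at h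
  have := congrArg (eval 1) h
  simp [sub_eq_zero] at this
  exact hx this.symm

theorem inv_one_sub_X_pow_mul_C_mem_orderAtOne (m : ℕ) {x : E} (hx : x ≠ 1) :
    (1 - RatFunc.X ^ m * RatFunc.C x : RatFunc E)⁻¹ ∈ orderAtOne E 0 := by
  refine ⟨1, 1 - X ^ m * C x, by simpa [sub_eq_zero] using hx.symm, ?_⟩
  rw [← one_sub_X_pow_mul_C_eq, inv_mul_cancel₀ (one_sub_X_pow_mul_C_ne_zero m hx)]
  simp

/-- The `q`-Pochhammer symbol `∏_{a < m} (1 - q ^ a x)`. -/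
noncomputable def qPoch (x : E) (m : ℕ) : RatFunc E :=
  ∏ a ∈ Finset.range m, (1 - RatFunc.X ^ a * RatFunc.C x)

theorem qPoch_ne_zero {x : E} (hx : x ≠ 1) (m : ℕ) : qPoch x m ≠ 0 :=
  Finset.prod_ne_zero_iff.2 fun a _ => one_sub_X_pow_mul_C_ne_zero a hx

variable {α V : Type*} [AddCommMonoid V]

theorem smallDiff_X_pow (c : α → V) (d : V →+ ℕ) (N : ℕ) :
    SmallDiff (orderAtOne E) c N 0 (fun n => (RatFunc.X : RatFunc E) ^ d n) := by
  have hmem : ∀ n, (RatFunc.X : RatFunc E) ^ d n ∈ orderAtOne E 0 := fun n => by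
    simpa using algebraMap_mem_orderAtOne ((X : E[X]) ^ d n)
  induction N with
  | zero => exact hmem
  | succ N ih =>
    refine ⟨hmem, fun g => ?_⟩
    have := ih.mul mul_mem_orderAtOne
      (SmallDiff.const (X_pow_sub_one_mem_orderAtOne (d (c g))) N)
    convert this using 2 with n
    simp only [map_add, pow_add]
    ring

theorem smallDiff_one_sub_X_pow (c : α → V) (d : V →+ ℕ) (a : ℕ) (x : E) (N : ℕ) :
    SmallDiff (orderAtOne E) c N 0
      (fun n => 1 - (RatFunc.X : RatFunc E) ^ (d n + a) * RatFunc.C x) := by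
  have hx : (-(RatFunc.X ^ a * RatFunc.C x) : RatFunc E) ∈ orderAtOne E 0 := by
    have h := algebraMap_mem_orderAtOne (X ^ a * C x : E[X])
    rw [map_mul, map_pow, RatFunc.algebraMap_X, RatFunc.algebraMap_C] at h
    exact neg_mem h
  convert (SmallDiff.const one_mem_orderAtOne N).add
    ((smallDiff_X_pow c d N).mul mul_mem_orderAtOne (SmallDiff.const hx N)) using 2 with n
  rw [pow_add]
  ring

theorem smallRatio_qPoch (c : α → V) (d : V →+ ℕ) {x : E} (hx : x ≠ 1) :
    SmallRatio (orderAtOne E) c (fun n => qPoch x (d n)) := by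
  have hratio : ∀ g n, qPoch x (d (n + c g)) / qPoch x (d n) =
      ∏ a ∈ Finset.range (d (c g)), (1 - RatFunc.X ^ (d n + a) * RatFunc.C x) := by
    intro g n
    rw [div_eq_iff (qPoch_ne_zero hx _), map_add, qPoch, Finset.prod_range_add, mul_comm]
    rfl
  refine ⟨fun n => qPoch_ne_zero hx _, fun g N => ?_, fun g N => ?_⟩
  · simp only [hratio]
    exact SmallDiff.prod mul_mem_orderAtOne one_mem_orderAtOne _ fun a _ =>
      smallDiff_one_sub_X_pow c d a x N
  · simp only [← inv_div (qPoch x (d (_ + c g))), hratio, ← Finset.prod_inv_distrib]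
    exact SmallDiff.prod mul_mem_orderAtOne one_mem_orderAtOne _ fun a _ =>
      (smallDiff_one_sub_X_pow c d a x N).inv mul_mem_orderAtOne
        (fun n => one_sub_X_pow_mul_C_ne_zero _ hx)
        (fun n => inv_one_sub_X_pow_mul_C_mem_orderAtOne _ hx)

end OrderAtOne

section Hook

theorem prod_Ico_prod_Ico_of_antitone {K : Type*} [CommMonoid K] {μ : ℕ → ℕ} (hμ : Antitone μ)
    (G : ℕ → K) {i N : ℕ} (hi : i ≤ N) :
    ∏ k ∈ Finset.Ico i N, ∏ j ∈ Finset.Ico (μ (k + 1)) (μ k), G j =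
      ∏ j ∈ Finset.Ico (μ N) (μ i), G j := by
  induction N, hi using Nat.le_induction with
  | base => simp
  | succ N hN ih =>
    rw [Finset.prod_Ico_succ_top hN, ih, mul_comm,
      Finset.prod_Ico_consecutive _ (hμ (Nat.le_succ N)) (hμ hN)]

theorem prod_Ico_reflect_mul_prod_range {K : Type*} [CommMonoid K] (G : ℕ → K) {a b A : ℕ}
    (hab : a ≤ b) (hbA : b ≤ A) :
    (∏ j ∈ Finset.Ico a b, G (A - j - 1)) * ∏ x ∈ Finset.range (A - b), G x =
      ∏ x ∈ Finset.range (A - a), G x := by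
  induction b, hab using Nat.le_induction with
  | base => simp
  | succ b hb ih =>
    rw [Finset.prod_Ico_succ_top hb, ← ih (by omega), mul_assoc,
      show A - b = A - (b + 1) + 1 by omega, Finset.prod_range_succ, Nat.add_sub_cancel,
      mul_comm (G _)]

theorem ratFunc_X_pow_ne_one {m : ℕ} (hm : m ≠ 0) : (RatFunc.X : RatFunc ℚ) ^ m ≠ 1 := by
  rw [← RatFunc.algebraMap_X, ← map_pow, ← map_one (algebraMap (Polynomial ℚ) (RatFunc ℚ))]
  intro h
  have := congrArg Polynomial.natDegree (RatFunc.algebraMap_injective ℚ h)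
  simp [hm] at this

/-- The `(q,t)`-hook polynomial as a product over pairs of rows. -/
theorem hookPoly_eq_prod (μ : PartitionFun) {N : ℕ} (hN : ∀ i, N ≤ i → μ.toFun i = 0) :
    hookPoly μ = ∏ i ∈ Finset.range N, ∏ k ∈ Finset.Ico i N,
      (qPoch ((RatFunc.X : RatFunc ℚ) ^ (k + 1 - i)) (μ.toFun i - μ.toFun (k + 1)) /
        qPoch ((RatFunc.X : RatFunc ℚ) ^ (k + 1 - i)) (μ.toFun i - μ.toFun k)) := by
  have hμ : Antitone μ.toFun := μ.antitone'
  unfold hookPoly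
  rw [finprod_cond_eq_prod_of_cond_iff (p := fun p : ℕ × ℕ => p.2 < μ.toFun p.1) _
      (t := (Finset.range N).biUnion fun i => (Finset.range (μ.toFun i)).image (Prod.mk i)),
    Finset.prod_finset_product _ (Finset.range N) (fun i => Finset.range (μ.toFun i))]
  · refine Finset.prod_congr rfl fun i hi => ?_
    rw [Finset.mem_range] at hi
    rw [Finset.range_eq_Ico, ← hN N le_rfl, ← prod_Ico_prod_Ico_of_antitone hμ _ hi.le]
    refine Finset.prod_congr rfl fun k hk => ?_
    rw [Finset.mem_Ico] at hk
    rw [eq_div_iff (qPoch_ne_zero (ratFunc_X_pow_ne_one (by omega)) _), qPoch, qPoch,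
      ← prod_Ico_reflect_mul_prod_range _ (hμ (Nat.le_succ k)) (hμ hk.1)]
    congr 1
    refine Finset.prod_congr rfl fun j hj => ?_
    rw [Finset.mem_Ico] at hj
    have hset : {i' : ℕ | j < μ.toFun i'} = (Finset.range (k + 1) : Set ℕ) := by
      ext i'
      simp only [Set.mem_ofPred_eq, Finset.coe_range, Set.mem_Iio]
      constructor
      · intro h
        by_contra! h'
        exact absurd (h.trans_le (hμ h')) hj.1.not_gt
      · intro h
        exact hj.2.trans_le (hμ (Nat.lt_succ_iff.1 h))
    simp only [hset, Set.ncard_coe_finset, Finset.card_range, map_pow]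
    rw [show k + 1 - i - 1 + 1 = k + 1 - i by omega]
  · rintro ⟨i, j⟩
    simp
  · rintro ⟨i, j⟩ -
    simp only [Finset.mem_biUnion, Finset.mem_range, Finset.mem_image, Prod.mk.injEq]
    constructor
    · intro h
      refine ⟨i, ?_, j, h, rfl, rfl⟩
      by_contra! h'
      simp [hN i h'] at h
    · rintro ⟨i, -, j, h, rfl, rfl⟩
      exact h

/-- The difference of two rows of `∑ g, n g • λ^g`, as an additive function of `n`. -/
def rowDiff {r : ℕ} (lam : Fin r → PartitionFun) (i k : ℕ) : (Fin r → ℕ) →+ ℕ where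
  toFun n := ∑ g, n g * ((lam g).toFun i - (lam g).toFun k)
  map_zero' := by simp
  map_add' := by simp [add_mul, Finset.sum_add_distrib]

theorem rowDiff_sum_single {r : ℕ} (lam : Fin r → PartitionFun) {i k : ℕ} (hik : i ≤ k)
    (I : Finset (Fin r)) :
    rowDiff lam i k (∑ g ∈ I, Pi.single g 1) =
      (partSum lam I).toFun i - (partSum lam I).toFun k := by
  rw [map_sum]
  simp only [partSum]
  rw [← Finset.sum_tsub_distrib _ fun g _ => (lam g).antitone' hik]
  refine Finset.sum_congr rfl fun g _ => ?_
  simp [rowDiff, Pi.single_apply]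

theorem exists_forall_toFun_eq_zero {r : ℕ} (lam : Fin r → PartitionFun) :
    ∃ N, ∀ g i, N ≤ i → (lam g).toFun i = 0 := by
  have h : ∀ g, ∃ N, ∀ i, N ≤ i → (lam g).toFun i = 0 := fun g => by
    obtain ⟨N, hN⟩ := (lam g).finite_support'.bddAbove
    refine ⟨N + 1, fun i hi => ?_⟩
    by_contra h
    exact absurd (hN (Function.mem_support.2 h)) (by omega)
  choose N hN using h
  exact ⟨Finset.univ.sup N, fun g i hi => hN g i ((Finset.le_sup (Finset.mem_univ g)).trans hi)⟩

end Hook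

/-- the family `u_I = h_{(q,t)}(λ^I)` has the small cumulant property at
`q = 1`: for every `H ⊆ [r]` with `|H| ≥ 2`,
`κ_H(u)/(∏_{h∈H} u_{{h}}) = O_1((q−1)^{|H|−1})`. -/
theorem hook_small_cumulants (r : ℕ) (hr : 0 < r) (lam : Fin r → PartitionFun)
    (H : Finset (Fin r)) (hH : 2 ≤ H.card) :
    IsOAt (1 : RatFunc ℚ)
      (cumulant (fun I => hookPoly (partSum lam I)) H /
        ∏ h ∈ H, hookPoly (partSum lam {h}))
      ((RatFunc.X - 1) ^ (H.card - 1)) := by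
  obtain ⟨N, hN⟩ := exists_forall_toFun_eq_zero lam
  set c : Fin r → (Fin r → ℕ) := fun g => Pi.single g 1
  set F : (Fin r → ℕ) → RatFunc (RatFunc ℚ) := fun n =>
    ∏ i ∈ Finset.range N, ∏ k ∈ Finset.Ico i N,
      (qPoch ((RatFunc.X : RatFunc ℚ) ^ (k + 1 - i)) (rowDiff lam i (k + 1) n) /
        qPoch ((RatFunc.X : RatFunc ℚ) ^ (k + 1 - i)) (rowDiff lam i k n)) with hF
  have hsmall : SmallRatio (orderAtOne (RatFunc ℚ)) c F := by
    refine SmallRatio.prod mul_mem_orderAtOne one_mem_orderAtOne _ fun i _ =>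
      SmallRatio.prod mul_mem_orderAtOne one_mem_orderAtOne _ fun k hk => ?_
    have hx : (RatFunc.X : RatFunc ℚ) ^ (k + 1 - i) ≠ 1 :=
      ratFunc_X_pow_ne_one (by have := Finset.mem_Ico.1 hk; omega)
    exact (smallRatio_qPoch c _ hx).div mul_mem_orderAtOne (smallRatio_qPoch c _ hx)
  have hF0 : F 0 = 1 := by simp [hF, qPoch]
  have hhook : ∀ I, hookPoly (partSum lam I) = F (∑ g ∈ I, c g) := by
    intro I
    rw [hookPoly_eq_prod _ (N := N) fun i hi => Finset.sum_eq_zero fun g _ => hN g i hi]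
    refine Finset.prod_congr rfl fun i _ => Finset.prod_congr rfl fun k hk => ?_
    have hik := (Finset.mem_Ico.1 hk).1
    rw [rowDiff_sum_single lam hik, rowDiff_sum_single lam (hik.trans k.le_succ)]
  have hfam : (fun I => hookPoly (partSum lam I)) = shiftFamily c F 0 := by
    funext I
    simp only [hhook, shiftFamily, hF0, zero_add, div_one]
  obtain ⟨g, hg⟩ : H.Nonempty := Finset.card_pos.1 (by omega)
  have hκ := (smallDiff_cumulant mul_mem_orderAtOne c hsmall.ne_zero hsmall.ratio (H.erase g) g
    (Finset.notMem_erase g H) 0).mem 0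
  rw [Finset.insert_erase hg, Finset.card_erase_of_mem hg] at hκ
  have hden : (∏ h ∈ H, hookPoly (partSum lam {h}))⁻¹ ∈ orderAtOne (RatFunc ℚ) 0 := by
    have := (SmallDiff.prod (c := c) mul_mem_orderAtOne one_mem_orderAtOne H fun h _ =>
      hsmall.ratio_inv h 0).mem 0
    simpa [hhook, hF0] using this
  rw [hfam, div_eq_mul_inv]
  exact mul_mem_orderAtOne hκ hden
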